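/- Let Σ be an FD set over {1,…,d}, let D ⊆ dom^d be a finite nonempty labeled ordered instance with labels in {0,1} such that every 0-labeled tuple of D precedes every 1-labeled tuple of D in the order <, and assume D contains at least one 0-labeled tuple. Then the test point is NOT certifiably robust for 1-NN classification with respect to the repairs of D w.r.t. Σ if and only if there exists a repair of D w.r.t. Σ all of whose tuples have label 1. -/

import Mathlib

/-- A set `I` of tuples satisfies the FD `fd = (X, B)` if any two tuples of `I`
agreeing on every attribute of `X` also agree on every attribute of `B`. -/
def SatFD {d : ℕ} {dom : Type*} (I : Finset (Fin d → dom))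
    (fd : Set (Fin d) × Set (Fin d)) : Prop :=
  ∀ s ∈ I, ∀ t ∈ I, (∀ a ∈ fd.1, s a = t a) → ∀ b ∈ fd.2, s b = t b

/-- `I` satisfies every FD of the FD set `FDs`. -/
def SatFDs {d : ℕ} {dom : Type*} (I : Finset (Fin d → dom))
    (FDs : Set (Set (Fin d) × Set (Fin d))) : Prop :=
  ∀ fd ∈ FDs, SatFD I fd

/-- `I` is a repair of `D` w.r.t. `FDs`: a subset of `D` satisfying `FDs` that is
maximal under inclusion among the subsets of `D` satisfying `FDs`. -/
def IsFDRepair {d : ℕ} {dom : Type*} (FDs : Set (Set (Fin d) × Set (Fin d)))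
    (D I : Finset (Fin d → dom)) : Prop :=
  I ⊆ D ∧ SatFDs I FDs ∧ ∀ J : Finset (Fin d → dom), I ⊆ J → J ⊆ D → SatFDs J FDs → J = I

/-- A single tuple satisfies every FD set. -/
theorem satFDs_singleton {d : ℕ} {dom : Type*} (FDs : Set (Set (Fin d) × Set (Fin d)))
    (t : Fin d → dom) : SatFDs {t} FDs := by
  intro fd _ s hs u hu _ b _
  rw [Finset.mem_singleton.mp hs, Finset.mem_singleton.mp hu]

/-- Every subset of `D` satisfying the FDs extends to a repair of `D`. -/
theorem exists_isFDRepair_superset {d : ℕ} {dom : Type*}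
    {FDs : Set (Set (Fin d) × Set (Fin d))} {D I : Finset (Fin d → dom)}
    (hID : I ⊆ D) (hI : SatFDs I FDs) : ∃ J, I ⊆ J ∧ IsFDRepair FDs D J := by
  have hfin : {K : Finset (Fin d → dom) | K ⊆ D ∧ SatFDs K FDs}.Finite :=
    D.powerset.finite_toSet.subset fun K hK => by simpa using hK.1
  obtain ⟨J, hIJ, hJ⟩ := hfin.exists_le_maximal (a := I) ⟨hID, hI⟩
  exact ⟨J, hIJ, hJ.prop.1, hJ.prop.2,
    fun K hJK hKD hK => (hJ.eq_of_le ⟨hKD, hK⟩ hJK).symm⟩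

/-- A repair of a nonempty instance is nonempty. -/
theorem IsFDRepair.nonempty {d : ℕ} {dom : Type*}
    {FDs : Set (Set (Fin d) × Set (Fin d))} {D I : Finset (Fin d → dom)}
    (hI : IsFDRepair FDs D I) (hD : D.Nonempty) : I.Nonempty := by
  obtain ⟨t, ht⟩ := hD
  by_contra h
  rw [Finset.not_nonempty_iff_eq_empty] at h
  subst h
  exact Finset.singleton_ne_empty t (hI.2.2 {t} (Finset.empty_subset _)
    (Finset.singleton_subset_iff.mpr ht) (satFDs_singleton FDs t))

theorem stmt15 {d : ℕ} {dom : Type*} [DecidableEq dom] [LinearOrder (Fin d → dom)]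
    (FDs : Set (Set (Fin d) × Set (Fin d)))
    (D : Finset (Fin d → dom)) (hD : D.Nonempty)
    (L : (Fin d → dom) → Bool)
    -- every 0-labeled tuple precedes every 1-labeled tuple
    (hord : ∀ s ∈ D, ∀ t ∈ D, L s = false → L t = true → s < t)
    -- D contains at least one 0-labeled tuple
    (h0 : ∃ t ∈ D, L t = false) :
    -- the test point is NOT certifiably robust for 1-NN classification
    -- (the <-minimal tuples of the repairs do not all carry one common label)
    (¬ ∃ ℓ : Bool, ∀ I : Finset (Fin d → dom), IsFDRepair FDs D I →
        ∀ t ∈ I, (∀ u ∈ I, t ≤ u) → L t = ℓ) ↔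
      ∃ I : Finset (Fin d → dom), IsFDRepair FDs D I ∧ ∀ t ∈ I, L t = true := by
  constructor
  · intro h
    push Not at h
    obtain ⟨I, hI, t, htI, hmin, ht⟩ := h false
    refine ⟨I, hI, fun u hu => ?_⟩
    by_contra hLu
    exact (hord u (hI.1 hu) t (hI.1 htI) (by simpa using hLu) (by simpa using ht)).not_ge
      (hmin u hu)
  · rintro ⟨I, hI, hI1⟩ ⟨ℓ, hℓ⟩
    have hne := hI.nonempty hD
    have hℓ1 : ℓ = true := by
      rw [← hℓ I hI (I.min' hne) (I.min'_mem hne) fun u hu => I.min'_le u hu]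
      exact hI1 _ (I.min'_mem hne)
    obtain ⟨t, htD, ht⟩ := h0
    obtain ⟨J, htJ, hJ⟩ := exists_isFDRepair_superset
      (Finset.singleton_subset_iff.mpr htD) (satFDs_singleton FDs t)
    rw [Finset.singleton_subset_iff] at htJ
    have hmem := J.min'_mem ⟨t, htJ⟩
    have hmin := hℓ J hJ _ hmem fun u hu => J.min'_le u hu
    exact (hord t htD _ (hJ.1 hmem) ht (hmin.trans hℓ1)).not_ge (J.min'_le t htJ)
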